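/- arXiv:2407.05071 — 2 statements merged into one kernel-verified Lean document; each statement's English description precedes it below -/
import Mathlib

section
/- Fix K > 0. For every ε > 0 there exists γ = γ(ε, K) > 0 such that every measurable set A ⊆ 𝕋_K² with δ(A) ≥ m₁(𝕋_K²) + ε satisfies s(1; A) > γ. -/
open MeasureTheory Filter
open scoped ENNReal

noncomputable section

/-- The Haar measure on the `K × K` torus `𝕋_K² = ℝ²/(Kℤ²)` (total mass `K²`). -/
def torusVolume (K : ℝ) : Measure (AddCircle K × AddCircle K) :=
  if hK : 0 < K then
    haveI : Fact (0 < K) := ⟨hK⟩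
    (volume : Measure (AddCircle K × AddCircle K))
  else 0

/-- Normalized density of a subset of the torus `𝕋_K²`. -/
def density (K : ℝ) (A : Set (AddCircle K × AddCircle K)) : ℝ :=
  (torusVolume K A).toReal / K ^ 2

/-- Autocorrelation function `f(x; A) = δ(A ∩ (A - x))`. -/
def autocorr (K : ℝ) (A : Set (AddCircle K × AddCircle K))
    (x : AddCircle K × AddCircle K) : ℝ :=
  density K (A ∩ (fun y => y + x) ⁻¹' A)

/-- Radialized pair correlation function `f°(r; A)`. -/
def paircorr (K : ℝ) (A : Set (AddCircle K × AddCircle K)) (r : ℝ) : ℝ :=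
  (1 / (2 * Real.pi)) * ∫ θ in (0:ℝ)..(2 * Real.pi),
    autocorr K A (((r * Real.cos θ : ℝ) : AddCircle K), ((r * Real.sin θ : ℝ) : AddCircle K))

/-- Normalized pair correlation `s(r; A) = f°(r; A) / δ(A)²`. -/
def scorr (K : ℝ) (A : Set (AddCircle K × AddCircle K)) (r : ℝ) : ℝ :=
  paircorr K A r / density K A ^ 2

/-- `m₁(𝕋_K²)`: the supremum of densities of measurable 1-avoiding subsets of the torus. -/
def m1Torus (K : ℝ) : ℝ :=
  sSup {d : ℝ | ∃ A : Set (AddCircle K × AddCircle K),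
    MeasurableSet A ∧ paircorr K A 1 = 0 ∧ d = density K A}

end

open scoped Topology

theorem exists_weak_limit_memLp_two {X : Type*} [MeasurableSpace X]
    [MeasurableSpace.CountablyGenerated X] {μ : Measure X} [IsFiniteMeasure μ]
    {A : ℕ → Set X} (hA : ∀ n, MeasurableSet (A n)) :
    ∃ g : X → ℝ, MemLp g 2 μ ∧ ∃ φ : ℕ → ℕ, StrictMono φ ∧ ∀ f : X → ℝ, MemLp f 2 μ →
      Tendsto (fun n => ∫ x in A (φ n), f x ∂μ) atTop (𝓝 (∫ x, g x * f x ∂μ)) := by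
  have : Fact ((2 : ℝ≥0∞) ≠ ∞) := ⟨by simp⟩
  let a : ℕ → Lp ℝ 2 μ := fun n => indicatorConstLp 2 (hA n) (measure_ne_top μ _) 1
  obtain ⟨R, hR⟩ : ∃ R : ℝ, ∀ n, ‖a n‖ ≤ R := by
    refine ⟨μ.real Set.univ ^ (1 / (2 : ℝ≥0∞).toReal), fun n => ?_⟩
    refine norm_indicatorConstLp_le.trans ?_
    rw [norm_one, one_mul]
    exact Real.rpow_le_rpow measureReal_nonneg (measureReal_mono (Set.subset_univ _))
      (by positivity)
  obtain ⟨l, -, φ, hφ, hl⟩ := WeakDual.isSeqCompact_closedBall ℝ (Lp ℝ 2 μ) 0 R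
    (x := fun n => StrongDual.toWeakDual (InnerProductSpace.toDual ℝ (Lp ℝ 2 μ) (a n)))
    (fun n => by simpa using hR n)
  let g : Lp ℝ 2 μ := (InnerProductSpace.toDual ℝ (Lp ℝ 2 μ)).symm (WeakDual.toStrongDual l)
  refine ⟨g, Lp.memLp g, φ, hφ, fun f hf => ?_⟩
  have h := ((WeakDual.eval_continuous (𝕜 := ℝ) hf.toLp).tendsto l).comp hl
  have h1 : ∀ n, ∫ x in A (φ n), f x ∂μ = inner ℝ (a (φ n)) hf.toLp := by
    intro n
    rw [L2.inner_indicatorConstLp_one]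
    exact (setIntegral_congr_ae (hA _) (hf.coeFn_toLp.mono fun x hx _ => hx)).symm
  have h2 : ∫ x, g x * f x ∂μ = inner ℝ g hf.toLp := by
    rw [L2.inner_def]
    refine integral_congr_ae (hf.coeFn_toLp.mono fun x hx => ?_)
    simp [hx, mul_comm]
  have h3 : inner ℝ g hf.toLp = l hf.toLp :=
    InnerProductSpace.toDual_symm_apply (𝕜 := ℝ) (E := Lp ℝ 2 μ)
  simp_rw [h1, h2, h3]
  exact h

theorem exists_weak_limit_indicator {X : Type*} [TopologicalSpace X] [CompactSpace X]
    [R1Space X] [SecondCountableTopology X] [NormalSpace X]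
    [MeasurableSpace X] [BorelSpace X] {μ : Measure X} [IsFiniteMeasure μ] [μ.Regular]
    {A : ℕ → Set X} (hA : ∀ n, MeasurableSet (A n)) :
    ∃ g : X → ℝ, Measurable g ∧ (∀ x, g x ∈ Set.Icc (0 : ℝ) 1) ∧
      ∃ φ : ℕ → ℕ, StrictMono φ ∧ ∀ f : X → ℝ, Integrable f μ →
        Tendsto (fun n => ∫ x in A (φ n), f x ∂μ) atTop (𝓝 (∫ x, g x * f x ∂μ)) := by
  obtain ⟨g₀, hg₀, φ, hφ, hlim⟩ := exists_weak_limit_memLp_two (μ := μ) hA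
  have hint : Integrable g₀ μ := hg₀.integrable (by norm_num)
  have hset : ∀ s, MeasurableSet s →
      Tendsto (fun n => μ.real (s ∩ A (φ n))) atTop (𝓝 (∫ x in s, g₀ x ∂μ)) := by
    intro s hs
    convert hlim (s.indicator 1) ((memLp_const (1 : ℝ)).indicator hs) using 2
    · rw [integral_indicator_one hs, measureReal_restrict_apply hs]
    · rw [← integral_indicator hs]
      congr 1 with x
      by_cases hx : x ∈ s <;> simp [hx]
  have h0 : 0 ≤ᵐ[μ] g₀ := ae_nonneg_of_forall_setIntegral_nonneg hint fun s hs _ =>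
    ge_of_tendsto' (hset s hs) fun n => measureReal_nonneg
  have h1 : g₀ ≤ᵐ[μ] fun _ => (1 : ℝ) :=
    ae_le_of_forall_setIntegral_le hint (integrable_const _) fun s hs _ => by
      refine le_of_tendsto' (hset s hs) fun n => ?_
      simpa using measureReal_mono (μ := μ) (Set.inter_subset_left (s := s) (t := A (φ n)))
  let g₁ := hint.aestronglyMeasurable.mk g₀
  let g : X → ℝ := fun x => max 0 (min 1 (g₁ x))
  have hg₁ : Measurable g₁ := hint.aestronglyMeasurable.stronglyMeasurable_mk.measurable
  have hgm : Measurable g := measurable_const.max (measurable_const.min hg₁)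
  have hg01 : ∀ x, g x ∈ Set.Icc (0 : ℝ) 1 := fun x => by simp [g]
  have hgg : g =ᵐ[μ] g₀ := by
    filter_upwards [h0, h1, hint.aestronglyMeasurable.ae_eq_mk] with x h0 h1 hx
    simp only [g, g₁, ← hx]
    rw [min_eq_right h1, max_eq_right (by simpa using h0)]
  refine ⟨g, hgm, hg01, φ, hφ, fun f hf => ?_⟩
  have hgf : ∀ k : X → ℝ, Integrable k μ → Integrable (fun x => g x * k x) μ := fun k hk =>
    hk.bdd_mul (c := 1) hgm.aestronglyMeasurable
      (Eventually.of_forall fun x => by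
        rw [Real.norm_eq_abs, abs_of_nonneg (hg01 x).1]; exact (hg01 x).2)
  rw [Metric.tendsto_atTop]
  intro ε hε
  obtain ⟨k, -, hk, hkc, hki⟩ := hf.exists_hasCompactSupport_integral_sub_le (ε := ε / 3)
    (by positivity)
  have hk2 : MemLp k 2 μ := hkc.memLp_of_hasCompactSupport (HasCompactSupport.of_compactSpace k)
  have hk' := hlim k hk2
  rw [Metric.tendsto_atTop] at hk'
  obtain ⟨N, hN⟩ := hk' (ε / 3) (by positivity)
  refine ⟨N, fun n hn => ?_⟩
  have e1 : |∫ x in A (φ n), f x ∂μ - ∫ x in A (φ n), k x ∂μ| ≤ ε / 3 := by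
    rw [← integral_sub hf.integrableOn hki.integrableOn]
    refine (abs_integral_le_integral_abs).trans (le_trans ?_ hk)
    exact setIntegral_le_integral (hf.sub hki).norm (Eventually.of_forall fun x => abs_nonneg _)
  have e2 : |∫ x, g x * f x ∂μ - ∫ x, g x * k x ∂μ| ≤ ε / 3 := by
    rw [← integral_sub (hgf f hf) (hgf k hki)]
    refine (abs_integral_le_integral_abs).trans (le_trans ?_ hk)
    refine integral_mono ((hgf f hf).sub (hgf k hki)).norm (hf.sub hki).norm fun x => ?_
    simp only [← mul_sub, Real.norm_eq_abs, abs_mul]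
    rw [abs_of_nonneg (hg01 x).1]
    exact mul_le_of_le_one_left (abs_nonneg _) (hg01 x).2
  have e3 : |∫ x in A (φ n), k x ∂μ - ∫ x, g x * k x ∂μ| < ε / 3 := by
    have := hN n hn
    rwa [Real.dist_eq, show ∫ x, g₀ x * k x ∂μ = ∫ x, g x * k x ∂μ from
      integral_congr_ae (hgg.mono fun x hx => by simp [hx])] at this
  rw [Real.dist_eq]
  rw [abs_le] at e1 e2
  rw [abs_lt] at e3 ⊢
  constructor <;> linarith

theorem integrable_of_abs_le_one {X : Type*} [MeasurableSpace X] {μ : Measure X}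
    [IsFiniteMeasure μ] {f : X → ℝ} (hf : Measurable f) (h : ∀ x, |f x| ≤ 1) : Integrable f μ :=
  Integrable.of_bound hf.aestronglyMeasurable 1 (Eventually.of_forall h)

theorem abs_mul_le_one {a b : ℝ} (ha : |a| ≤ 1) (hb : |b| ≤ 1) : |a * b| ≤ 1 := by
  rw [abs_mul]
  exact mul_le_one₀ ha (abs_nonneg _) hb

section Averaging

variable {G Θ : Type*} [AddCommGroup G] [MeasurableSpace G] [MeasurableAdd₂ G]
  [MeasurableSpace Θ] {μ : Measure G} [IsFiniteMeasure μ]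
  {τ : Measure Θ} [IsFiniteMeasure τ] {c : Θ → G}

theorem integrable_average (hc : Measurable c) {u : G → ℝ} (hu : Measurable u)
    (hu1 : ∀ x, |u x| ≤ 1) : Integrable (fun x => ∫ θ, u (x + c θ) ∂τ) μ :=
  Integrable.integral_prod_left (f := fun p : G × Θ => u (p.1 + c p.2))
    (integrable_of_abs_le_one (by fun_prop) fun _ => hu1 _)

theorem setIntegral_average_support_eq_zero (hc : Measurable c) {g : G → ℝ} (hg : Measurable g)
    (hg01 : ∀ x, g x ∈ Set.Icc (0 : ℝ) 1)
    (h0 : ∫ x, g x * ∫ θ, g (x + c θ) ∂τ ∂μ = 0) :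
    ∫ x in {x | 0 < g x}, ∫ θ, {x | 0 < g x}.indicator (1 : G → ℝ) (x + c θ) ∂τ ∂μ = 0 := by
  have hg1 : ∀ x, |g x| ≤ 1 := fun x => by rw [abs_of_nonneg (hg01 x).1]; exact (hg01 x).2
  have hB : MeasurableSet {x | 0 < g x} := measurableSet_lt measurable_const hg
  simp_rw [← integral_const_mul] at h0
  have hint : Integrable (fun p : G × Θ => g p.1 * g (p.1 + c p.2)) (μ.prod τ) :=
    integrable_of_abs_le_one (by fun_prop) fun _ => abs_mul_le_one (hg1 _) (hg1 _)
  rw [integral_integral hint, integral_eq_zero_iff_of_nonneg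
    (fun p => mul_nonneg (hg01 _).1 (hg01 _).1) hint] at h0
  rw [← integral_indicator hB]
  refine integral_eq_zero_of_ae ?_
  filter_upwards [Measure.ae_ae_of_ae_prod h0] with x hx
  by_cases hxB : 0 < g x
  · rw [Set.indicator_of_mem (by exact hxB)]
    refine integral_eq_zero_of_ae ?_
    filter_upwards [hx] with θ hθ
    have : g (x + c θ) = 0 := (mul_eq_zero.1 hθ).resolve_left hxB.ne'
    simp [this]
  · simp [hxB]

variable [MeasurableNeg G] [μ.IsAddLeftInvariant]

theorem integral_sq_average_eq (hc : Measurable c) {u : G → ℝ} (hu : Measurable u)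
    (hu1 : ∀ x, |u x| ≤ 1) :
    ∫ x, (∫ θ, u (x + c θ) ∂τ) ^ 2 ∂μ =
      ∫ x, u x * ∫ w, u (x + w) ∂((τ.prod τ).map fun p => c p.2 - c p.1) ∂μ := by
  have hd : Measurable fun p : Θ × Θ => c p.2 - c p.1 := by fun_prop
  calc ∫ x, (∫ θ, u (x + c θ) ∂τ) ^ 2 ∂μ
      = ∫ x, ∫ p, u (x + c p.1) * u (x + c p.2) ∂(τ.prod τ) ∂μ := by
        congr 1 with x
        rw [sq]
        exact (integral_prod_mul (fun θ => u (x + c θ)) (fun θ => u (x + c θ))).symm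
    _ = ∫ p, ∫ x, u (x + c p.1) * u (x + c p.2) ∂μ ∂(τ.prod τ) :=
        integral_integral_swap (integrable_of_abs_le_one (by fun_prop)
          fun _ => abs_mul_le_one (hu1 _) (hu1 _))
    _ = ∫ p, ∫ x, u x * u (x + (c p.2 - c p.1)) ∂μ ∂(τ.prod τ) := by
        congr 1 with p
        rw [← integral_add_right_eq_self (fun x => u x * u (x + (c p.2 - c p.1))) (c p.1)]
        congr 1 with x
        congr 2
        abel
    _ = ∫ x, ∫ p, u x * u (x + (c p.2 - c p.1)) ∂(τ.prod τ) ∂μ :=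
        integral_integral_swap (integrable_of_abs_le_one (by fun_prop)
          fun _ => abs_mul_le_one (hu1 _) (hu1 _))
    _ = _ := by
        congr 1 with x
        rw [integral_const_mul, integral_map hd.aemeasurable
          (by fun_prop : Measurable fun w => u (x + w)).aestronglyMeasurable]

theorem tendsto_integral_sq_average (hc : Measurable c)
    (hac : (τ.prod τ).map (fun p => c p.2 - c p.1) ≪ μ)
    {u : ℕ → G → ℝ} (hu : ∀ n, Measurable (u n)) (hu1 : ∀ n x, |u n x| ≤ 1)
    (hweak : ∀ f : G → ℝ, Integrable f μ →
      Tendsto (fun n => ∫ x, u n x * f x ∂μ) atTop (𝓝 0)) :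
    Tendsto (fun n => ∫ x, (∫ θ, u n (x + c θ) ∂τ) ^ 2 ∂μ) atTop (𝓝 0) := by
  simp_rw [fun n => integral_sq_average_eq (μ := μ) (τ := τ) hc (hu n) (hu1 n)]
  set ν := (τ.prod τ).map (fun p => c p.2 - c p.1)
  have hker : ∀ n x, ∫ w, u n (x + w) ∂ν =
      ∫ w, u n w * (ν.rnDeriv μ (w - x)).toReal ∂μ := by
    intro n x
    rw [← integral_rnDeriv_smul hac,
      ← integral_add_right_eq_self (fun w => u n w * (ν.rnDeriv μ (w - x)).toReal) x]
    congr 1 with w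
    simp [mul_comm, add_comm]
  have hk : ∀ x, Integrable (fun w => (ν.rnDeriv μ (w - x)).toReal) μ := fun x =>
    (Measure.integrable_toReal_rnDeriv (μ := ν) (ν := μ)).comp_sub_right x
  have hbound : ∀ n x, |∫ w, u n (x + w) ∂ν| ≤ ν.real Set.univ := by
    intro n x
    simpa using norm_integral_le_of_norm_le_const (μ := ν) (f := fun w => u n (x + w)) (C := 1)
      (Eventually.of_forall fun w => hu1 n _)
  rw [← integral_zero G ℝ (μ := μ)]
  refine tendsto_integral_of_dominated_convergence (fun _ => ν.real Set.univ) (fun n => ?_)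
    (integrable_const _) (fun n => Eventually.of_forall fun x => ?_)
    (Eventually.of_forall fun x => ?_)
  · refine (hu n).aestronglyMeasurable.mul ?_
    exact (StronglyMeasurable.integral_prod_right
      (f := fun x w => u n (x + w)) (Measurable.stronglyMeasurable
        (by have := hu n; fun_prop))).aestronglyMeasurable
  · rw [norm_mul]
    exact (mul_le_of_le_one_left (norm_nonneg _) (hu1 n x)).trans (hbound n x)
  · refine squeeze_zero_norm (a := fun n => ‖∫ w, u n (x + w) ∂ν‖) (fun n => ?_) ?_
    · rw [norm_mul]
      exact mul_le_of_le_one_left (norm_nonneg _) (hu1 n x)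
    · simp_rw [hker]
      simpa using (hweak _ (hk x)).norm

theorem tendsto_integral_abs_average (hc : Measurable c)
    (hac : (τ.prod τ).map (fun p => c p.2 - c p.1) ≪ μ)
    {u : ℕ → G → ℝ} (hu : ∀ n, Measurable (u n)) (hu1 : ∀ n x, |u n x| ≤ 1)
    (hweak : ∀ f : G → ℝ, Integrable f μ →
      Tendsto (fun n => ∫ x, u n x * f x ∂μ) atTop (𝓝 0)) :
    Tendsto (fun n => ∫ x, |∫ θ, u n (x + c θ) ∂τ| ∂μ) atTop (𝓝 0) := by
  have hsq := tendsto_integral_sq_average hc hac hu hu1 hweak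
  have hm : ∀ n, AEStronglyMeasurable (fun x => ∫ θ, u n (x + c θ) ∂τ) μ := fun n =>
    (StronglyMeasurable.integral_prod_right (f := fun x θ => u n (x + c θ))
      (Measurable.stronglyMeasurable (by have := hu n; fun_prop))).aestronglyMeasurable
  have hb : ∀ n x, |∫ θ, u n (x + c θ) ∂τ| ≤ τ.real Set.univ := by
    intro n x
    simpa using norm_integral_le_of_norm_le_const (μ := τ) (f := fun θ => u n (x + c θ)) (C := 1)
      (Eventually.of_forall fun w => hu1 n _)
  have hmem : ∀ n, MemLp (fun x => ∫ θ, u n (x + c θ) ∂τ) 2 μ := fun n =>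
    MemLp.of_bound (hm n) _ (Eventually.of_forall (hb n))
  have hcs : ∀ n, ∫ x, |∫ θ, u n (x + c θ) ∂τ| ∂μ ≤
      √(∫ x, (∫ θ, u n (x + c θ) ∂τ) ^ 2 ∂μ) * √(μ.real Set.univ) := by
    intro n
    have := integral_mul_norm_le_Lp_mul_Lq (μ := μ) (f := fun x => ∫ θ, u n (x + c θ) ∂τ)
      (g := fun _ => (1 : ℝ)) Real.HolderConjugate.two_two (by simpa using hmem n)
      (memLp_const _)
    simpa [Real.sqrt_eq_rpow] using this
  refine squeeze_zero (fun n => integral_nonneg fun x => abs_nonneg _) hcs ?_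
  simpa using (hsq.sqrt).mul_const (√(μ.real Set.univ))

theorem tendsto_setIntegral_average (hc : Measurable c)
    (hac : (τ.prod τ).map (fun p => c p.2 - c p.1) ≪ μ)
    {A : ℕ → Set G} (hA : ∀ n, MeasurableSet (A n)) {g : G → ℝ} (hg : Measurable g)
    (hg01 : ∀ x, g x ∈ Set.Icc (0 : ℝ) 1)
    (hweak : ∀ f : G → ℝ, Integrable f μ →
      Tendsto (fun n => ∫ x in A n, f x ∂μ) atTop (𝓝 (∫ x, g x * f x ∂μ))) :
    Tendsto (fun n => ∫ x in A n, ∫ θ, (A n).indicator 1 (x + c θ) ∂τ ∂μ) atTop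
      (𝓝 (∫ x, g x * ∫ θ, g (x + c θ) ∂τ ∂μ)) := by
  let a : ℕ → G → ℝ := fun n => (A n).indicator 1
  let u : ℕ → G → ℝ := fun n x => a n x - g x
  have ha : ∀ n, Measurable (a n) := fun n => measurable_one.indicator (hA n)
  have ha1 : ∀ n x, |a n x| ≤ 1 := fun n x => by
    by_cases hx : x ∈ A n <;> simp [a, hx]
  have hg1 : ∀ x, |g x| ≤ 1 := fun x => by rw [abs_of_nonneg (hg01 x).1]; exact (hg01 x).2
  have hu : ∀ n, Measurable (u n) := fun n => (ha n).sub hg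
  have hu1 : ∀ n x, |u n x| ≤ 1 := fun n x => by
    have := hg01 x
    rw [abs_le]
    by_cases hx : x ∈ A n <;> simp [u, a, hx] <;> constructor <;> linarith [this.1, this.2]
  have hw : ∀ f : G → ℝ, Integrable f μ →
      Tendsto (fun n => ∫ x, u n x * f x ∂μ) atTop (𝓝 0) := by
    intro f hf
    have h := (hweak f hf).sub_const (∫ x, g x * f x ∂μ)
    rw [sub_self] at h
    refine h.congr fun n => ?_
    rw [← integral_indicator (hA n), ← integral_sub (hf.indicator (hA n))
      (hf.bdd_mul (c := 1) hg.aestronglyMeasurable (Eventually.of_forall hg1))]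
    congr 1 with x
    by_cases hx : x ∈ A n <;> simp [u, a, hx, sub_mul]
  have hdiff : Tendsto (fun n => ∫ x in A n, ∫ θ, u n (x + c θ) ∂τ ∂μ) atTop (𝓝 0) := by
    refine squeeze_zero_norm (fun n => ?_) (tendsto_integral_abs_average hc hac hu hu1 hw)
    refine (norm_integral_le_integral_norm _).trans ?_
    exact setIntegral_le_integral (integrable_average hc (hu n) (hu1 n)).norm
      (Eventually.of_forall fun x => norm_nonneg _)
  have hsum := hdiff.add (hweak _ (integrable_average (τ := τ) hc hg hg1))
  rw [zero_add] at hsum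
  refine hsum.congr fun n => ?_
  rw [← integral_add (integrable_average hc (hu n) (hu1 n)).integrableOn
    (integrable_average hc hg hg1).integrableOn]
  congr 1 with x
  rw [← integral_add (integrable_of_abs_le_one (by have := hu n; fun_prop) fun _ => hu1 n _)
    (integrable_of_abs_le_one (by fun_prop) fun _ => hg1 _)]
  simp [u, a]

end Averaging

/-- The difference of two points of the unit circle with given arguments. -/
noncomputable def circleDiff (p : ℝ × ℝ) : ℝ × ℝ :=
  (Real.cos p.2 - Real.cos p.1, Real.sin p.2 - Real.sin p.1)

theorem contDiff_circleDiff : ContDiff ℝ 1 circleDiff := by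
  unfold circleDiff
  fun_prop

theorem exists_hasFDerivAt_circleDiff {p : ℝ × ℝ} (hp : Real.sin (p.1 - p.2) ≠ 0) :
    ∃ f' : (ℝ × ℝ) ≃L[ℝ] (ℝ × ℝ), HasFDerivAt circleDiff (f' : (ℝ × ℝ) →L[ℝ] (ℝ × ℝ)) p := by
  obtain ⟨a, b⟩ := p
  simp only [Real.sin_sub] at hp
  let L : (ℝ × ℝ) →L[ℝ] (ℝ × ℝ) :=
    (Real.sin a • ContinuousLinearMap.fst ℝ ℝ ℝ - Real.sin b • ContinuousLinearMap.snd ℝ ℝ ℝ).prod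
    (Real.cos b • ContinuousLinearMap.snd ℝ ℝ ℝ - Real.cos a • ContinuousLinearMap.fst ℝ ℝ ℝ)
  let D := Real.sin a * Real.cos b - Real.cos a * Real.sin b
  let M : (ℝ × ℝ) →L[ℝ] (ℝ × ℝ) :=
    ((Real.cos b / D) • ContinuousLinearMap.fst ℝ ℝ ℝ +
      (Real.sin b / D) • ContinuousLinearMap.snd ℝ ℝ ℝ).prod
    ((Real.cos a / D) • ContinuousLinearMap.fst ℝ ℝ ℝ +
      (Real.sin a / D) • ContinuousLinearMap.snd ℝ ℝ ℝ)
  have hD : D ≠ 0 := hp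
  refine ⟨ContinuousLinearEquiv.equivOfInverse L M (fun x => ?_) (fun x => ?_), ?_⟩
  · ext <;> simp [L, M] <;> field_simp <;> simp only [D] <;> ring
  · ext <;> simp [L, M] <;> field_simp <;> simp only [D] <;> ring
  · have h1 : HasFDerivAt (fun p : ℝ × ℝ => p.1) (ContinuousLinearMap.fst ℝ ℝ ℝ) (a, b) :=
      hasFDerivAt_fst
    have h2 : HasFDerivAt (fun p : ℝ × ℝ => p.2) (ContinuousLinearMap.snd ℝ ℝ ℝ) (a, b) :=
      hasFDerivAt_snd
    refine ((h2.cos.sub h1.cos).prodMk (h2.sin.sub h1.sin)).congr_fderiv ?_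
    change _ = L
    ext <;> simp [L]

theorem volume_sin_sub_eq_zero : volume {p : ℝ × ℝ | Real.sin (p.1 - p.2) = 0} = 0 := by
  have hm : MeasurableSet {p : ℝ × ℝ | Real.sin (p.1 - p.2) = 0} :=
    (isClosed_eq (by fun_prop) continuous_const).measurableSet
  rw [Measure.volume_eq_prod, Measure.measure_prod_null hm]
  refine Eventually.of_forall fun a => ?_
  refine ((Set.countable_range fun n : ℤ => a - n * Real.pi).mono ?_).measure_zero _
  intro b hb
  obtain ⟨n, hn⟩ := Real.sin_eq_zero_iff.1 hb
  exact ⟨n, by simp only [hn]; ring⟩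

theorem quasiMeasurePreserving_circleDiff :
    Measure.QuasiMeasurePreserving circleDiff volume volume := by
  refine ⟨contDiff_circleDiff.continuous.measurable, ?_⟩
  refine Measure.AbsolutelyContinuous.mk fun N hN hN0 => ?_
  rw [Measure.map_apply contDiff_circleDiff.continuous.measurable hN]
  refine measure_mono_null (t := {p : ℝ × ℝ | Real.sin (p.1 - p.2) = 0} ∪
    (circleDiff ⁻¹' N \ {p : ℝ × ℝ | Real.sin (p.1 - p.2) = 0}))
    (fun p hp => by by_cases h : Real.sin (p.1 - p.2) = 0 <;> simp_all) ?_
  refine measure_union_null volume_sin_sub_eq_zero ?_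
  refine measure_null_of_locally_null _ fun p hp => ?_
  obtain ⟨f', hf'⟩ := exists_hasFDerivAt_circleDiff hp.2
  have hc : ContDiffAt ℝ 1 circleDiff p := contDiff_circleDiff.contDiffAt
  let e := hc.toOpenPartialHomeomorph circleDiff hf' one_ne_zero
  have hinv : ContDiffAt ℝ 1 e.symm (circleDiff p) := hc.to_localInverse hf' one_ne_zero
  obtain ⟨V, hV, hVd⟩ : ∃ V ∈ 𝓝 (circleDiff p), ∀ y ∈ V, DifferentiableAt ℝ e.symm y := by
    exact ⟨_, hinv.eventually (by simp), fun y (hy : ContDiffAt ℝ 1 e.symm y) =>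
      hy.differentiableAt one_ne_zero⟩
  refine ⟨e.symm '' (N ∩ V), mem_nhdsWithin.2 ?_, ?_⟩
  · obtain ⟨W, hWV, hWo, hpW⟩ := mem_nhds_iff.1 hV
    refine ⟨e.source ∩ circleDiff ⁻¹' W,
      e.open_source.inter (hWo.preimage contDiff_circleDiff.continuous),
      ⟨hc.mem_toOpenPartialHomeomorph_source hf' one_ne_zero, hpW⟩, ?_⟩
    rintro q ⟨⟨hq, hqW⟩, hqN, -⟩
    exact ⟨circleDiff q, ⟨hqN, hWV hqW⟩, e.left_inv hq⟩
  · exact addHaar_image_eq_zero_of_differentiableOn_of_addHaar_eq_zero volume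
      (fun y hy => (hVd y hy.2).differentiableWithinAt)
      (measure_mono_null Set.inter_subset_left hN0)

theorem quasiMeasurePreserving_mk_prod (K : ℝ) [Fact (0 < K)] :
    Measure.QuasiMeasurePreserving
      (fun p : ℝ × ℝ => ((p.1 : AddCircle K), (p.2 : AddCircle K))) volume volume := by
  have hm : Measurable (fun p : ℝ × ℝ => ((p.1 : AddCircle K), (p.2 : AddCircle K))) :=
    (AddCircle.measurable_mk'.comp measurable_fst).prodMk
      (AddCircle.measurable_mk'.comp measurable_snd)
  refine ⟨hm, Measure.AbsolutelyContinuous.mk fun N hN hN0 => ?_⟩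
  rw [Measure.map_apply hm hN]
  refine measure_null_of_locally_null _ fun p _ => ?_
  have hK : 0 < K := Fact.out
  have hloc : ∀ t : ℝ, Set.Ioc (t - K / 2) (t - K / 2 + K) ∈ 𝓝 t := fun t =>
    Ioc_mem_nhds (by linarith) (by linarith)
  have hmp := ((AddCircle.measurePreserving_mk K (p.1 - K / 2)).prod
    (AddCircle.measurePreserving_mk K (p.2 - K / 2)))
  refine ⟨_, inter_mem_nhdsWithin _ (prod_mem_nhds (hloc p.1) (hloc p.2)), ?_⟩
  rw [← Measure.restrict_apply (hm hN), Measure.volume_eq_prod, ← Measure.prod_restrict]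
  exact (hmp.measure_preimage hN.nullMeasurableSet).trans hN0

/-- The projection of the unit circle to the torus, parametrized by angle. -/
noncomputable def unitCircleMap (K θ : ℝ) : AddCircle K × AddCircle K :=
  (((1 * Real.cos θ : ℝ) : AddCircle K), ((1 * Real.sin θ : ℝ) : AddCircle K))

theorem measurable_unitCircleMap (K : ℝ) [Fact (0 < K)] : Measurable (unitCircleMap K) :=
  (AddCircle.measurable_mk'.comp (by fun_prop)).prodMk (AddCircle.measurable_mk'.comp (by fun_prop))

theorem absolutelyContinuous_map_unitCircleMap_sub (K : ℝ) [Fact (0 < K)] (s : Set ℝ) :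
    (((volume.restrict s).prod (volume.restrict s)).map
      fun p => unitCircleMap K p.2 - unitCircleMap K p.1) ≪ volume := by
  have hq := (quasiMeasurePreserving_mk_prod K).comp quasiMeasurePreserving_circleDiff
  have hfun : (fun p : ℝ × ℝ => unitCircleMap K p.2 - unitCircleMap K p.1) =
      (fun p : ℝ × ℝ => ((p.1 : AddCircle K), (p.2 : AddCircle K))) ∘ circleDiff := by
    funext p
    simp [unitCircleMap, circleDiff]
  rw [hfun, Measure.prod_restrict]
  exact (Measure.restrict_le_self.absolutelyContinuous.map hq.measurable).trans
    hq.absolutelyContinuous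

theorem density_eq (K : ℝ) [hK : Fact (0 < K)] (A : Set (AddCircle K × AddCircle K)) :
    density K A = volume.real A / K ^ 2 := by
  simp [density, torusVolume, hK.out, Measure.real]

theorem density_nonneg (K : ℝ) [Fact (0 < K)] (A : Set (AddCircle K × AddCircle K)) :
    0 ≤ density K A := by
  rw [density_eq]; positivity

theorem density_le_one (K : ℝ) [hK : Fact (0 < K)] (A : Set (AddCircle K × AddCircle K)) :
    density K A ≤ 1 := by
  rw [density_eq, div_le_one (by have := hK.out; positivity)]
  refine (measureReal_mono (Set.subset_univ _)).trans_eq ?_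
  rw [Measure.real, Measure.volume_eq_prod, ← Set.univ_prod_univ, Measure.prod_prod,
    AddCircle.measure_univ, ENNReal.toReal_mul, ENNReal.toReal_ofReal hK.out.le, sq]

theorem density_le_m1Torus (K : ℝ) [Fact (0 < K)] {A : Set (AddCircle K × AddCircle K)}
    (hA : MeasurableSet A) (h : paircorr K A 1 = 0) : density K A ≤ m1Torus K := by
  refine le_csSup ⟨1, ?_⟩ ⟨A, hA, h, rfl⟩
  rintro d ⟨B, -, -, rfl⟩
  exact density_le_one K B

theorem paircorr_one_eq (K : ℝ) [Fact (0 < K)] {A : Set (AddCircle K × AddCircle K)}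
    (hA : MeasurableSet A) :
    paircorr K A 1 = 1 / (2 * Real.pi) / K ^ 2 * ∫ x in A, ∫ θ in Set.Ioc 0 (2 * Real.pi),
      A.indicator (1 : AddCircle K × AddCircle K → ℝ) (x + unitCircleMap K θ) := by
  have hc := measurable_unitCircleMap K
  have hcorr : ∀ θ, autocorr K A (unitCircleMap K θ) =
      (∫ x in A, A.indicator (1 : AddCircle K × AddCircle K → ℝ) (x + unitCircleMap K θ)) /
        K ^ 2 := by
    intro θ
    have hm : MeasurableSet ((fun y => y + unitCircleMap K θ) ⁻¹' A) :=
      (measurable_add_const _) hA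
    rw [autocorr, density_eq, Set.inter_comm, ← measureReal_restrict_apply hm,
      ← integral_indicator_one hm]
    rfl
  have hone : Measurable (A.indicator (1 : AddCircle K × AddCircle K → ℝ)) :=
    measurable_one.indicator hA
  rw [paircorr, intervalIntegral.integral_of_le (by positivity)]
  change _ * ∫ θ in _, autocorr K A (unitCircleMap K θ) = _
  simp_rw [hcorr]
  rw [integral_div, integral_integral_swap (integrable_of_abs_le_one (by fun_prop) fun p => ?_)]
  · ring
  · by_cases hp : p.2 + unitCircleMap K p.1 ∈ A <;> simp [Function.uncurry, hp]

/-- Supersaturation: fix `K > 0`. For every `ε > 0` there is `γ = γ(ε, K) > 0` such that every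
measurable `A ⊆ 𝕋_K²` with `δ(A) ≥ m₁(𝕋_K²) + ε` satisfies `s(1; A) > γ`. -/
theorem supersaturation (K : ℝ) (hK : 0 < K) :
    ∀ ε > (0:ℝ), ∃ γ > (0:ℝ), ∀ A : Set (AddCircle K × AddCircle K),
      MeasurableSet A → m1Torus K + ε ≤ density K A → γ < scorr K A 1 := by
  have : Fact (0 < K) := ⟨hK⟩
  intro ε hε
  by_contra! hcon
  choose A hA hdens hs using fun n : ℕ => hcon (1 / ((n : ℝ) + 1)) (by positivity)
  have hm1 : 0 ≤ m1Torus K := (density_nonneg K ∅).trans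
    (density_le_m1Torus K MeasurableSet.empty (by rw [paircorr_one_eq K .empty]; simp))
  let J : Set (AddCircle K × AddCircle K) → ℝ := fun A =>
    ∫ x in A, ∫ θ in Set.Ioc 0 (2 * Real.pi),
      A.indicator (1 : AddCircle K × AddCircle K → ℝ) (x + unitCircleMap K θ)
  have hJ0 : ∀ A, 0 ≤ J A := fun A => integral_nonneg fun x => integral_nonneg fun θ =>
    Set.indicator_nonneg (fun _ _ => zero_le_one) _
  have hpair : ∀ n, J (A n) ≤ 2 * Real.pi * K ^ 2 * (1 / ((n : ℝ) + 1)) := by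
    intro n
    have hd : 0 < density K (A n) := by linarith [hdens n]
    have hp : paircorr K (A n) 1 ≤ 1 / ((n : ℝ) + 1) := by
      have h1 := (div_le_iff₀ (by positivity)).1 (hs n)
      have h2 : density K (A n) ^ 2 ≤ 1 := pow_le_one₀ hd.le (density_le_one K _)
      exact h1.trans (mul_le_of_le_one_right (by positivity) h2)
    rw [paircorr_one_eq K (hA n), div_div, one_div_mul_eq_div, div_le_iff₀ (by positivity)] at hp
    linarith
  have hJlim : Tendsto (fun n => J (A n)) atTop (𝓝 0) :=
    squeeze_zero (fun n => hJ0 _) hpair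
      (by simpa only [mul_zero] using
        (tendsto_one_div_add_atTop_nhds_zero_nat (𝕜 := ℝ)).const_mul (2 * Real.pi * K ^ 2))
  obtain ⟨g, hg, hg01, φ, hφ, hweak⟩ := exists_weak_limit_indicator (μ := volume) hA
  have : (volume : Measure (AddCircle K × AddCircle K)).IsAddLeftInvariant := by
    rw [Measure.volume_eq_prod]
    infer_instance
  have hlim := tendsto_setIntegral_average (measurable_unitCircleMap K)
    (absolutelyContinuous_map_unitCircleMap_sub K (Set.Ioc 0 (2 * Real.pi)))
    (fun n => hA (φ n)) hg hg01 hweak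
  have hzero := tendsto_nhds_unique hlim (hJlim.comp hφ.tendsto_atTop)
  have hB : MeasurableSet {x | 0 < g x} := measurableSet_lt measurable_const hg
  have hBle : density K {x | 0 < g x} ≤ m1Torus K := by
    refine density_le_m1Torus K hB ?_
    rw [paircorr_one_eq K hB, setIntegral_average_support_eq_zero
      (measurable_unitCircleMap K) hg hg01 hzero, mul_zero]
  have hgB : ∫ x, g x ≤ volume.real {x | 0 < g x} := by
    rw [← integral_indicator_one hB]
    refine integral_mono (integrable_of_abs_le_one hg fun x => ?_)
      ((integrable_const (1 : ℝ)).indicator hB) fun x => ?_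
    · rw [abs_of_nonneg (hg01 x).1]
      exact (hg01 x).2
    · by_cases hx : 0 < g x
      · simpa [hx] using (hg01 x).2
      · simpa [hx] using not_lt.1 hx
  have hone := hweak (fun _ => 1) (integrable_const _)
  simp only [integral_const, smul_eq_mul, mul_one, measureReal_restrict_apply_univ] at hone
  have hge : (m1Torus K + ε) * K ^ 2 ≤ ∫ x, g x := by
    refine ge_of_tendsto' hone fun n => ?_
    have := hdens (φ n)
    rwa [density_eq, le_div_iff₀ (by positivity)] at this
  rw [density_eq, div_le_iff₀ (by positivity)] at hBle
  nlinarith [mul_pos hε (pow_pos hK 2)]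
end

section
/- For every ε > 0 there exists K₀ such that for every integer K ≥ K₀ there exists N₀ = N₀(K, ε) with the following property: for all integers N ≥ N₀, the independence number of 𝒢(N,K) satisfies α(𝒢(N,K)) ≥ (m₁(ℝ²) − ε)·(NK)². -/
open MeasureTheory Filter
open scoped ENNReal

noncomputable section

/-- Euclidean distance on `ℝ²`. -/
def euDist (p q : ℝ × ℝ) : ℝ := Real.sqrt ((p.1 - q.1) ^ 2 + (p.2 - q.2) ^ 2)

/-- A planar set avoiding Euclidean distance 1. -/
def Avoids1 (A : Set (ℝ × ℝ)) : Prop := ∀ p ∈ A, ∀ q ∈ A, euDist p q ≠ 1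

/-- Upper density of a planar set. -/
def upperDensity (A : Set (ℝ × ℝ)) : ℝ :=
  limsup (fun R : ℝ => (volume (A ∩ Set.Icc (-R, -R) (R, R))).toReal / (2 * R) ^ 2) atTop

/-- `m₁(ℝ²)`: the supremum of upper densities of measurable 1-avoiding planar sets. -/
def m1Plane : ℝ :=
  sSup {d : ℝ | ∃ A : Set (ℝ × ℝ), MeasurableSet A ∧ Avoids1 A ∧ d = upperDensity A}

/-- The closed grid square `[j/N,(j+1)/N] × [k/N,(k+1)/N]`, viewed inside the torus `𝕋_K²`. -/
def gridSquare (K N : ℕ) (v : Fin (N * K) × Fin (N * K)) :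
    Set (AddCircle (K : ℝ) × AddCircle (K : ℝ)) :=
  {q | ∃ p : ℝ × ℝ, q = ((p.1 : AddCircle (K : ℝ)), (p.2 : AddCircle (K : ℝ))) ∧
        (v.1 : ℝ) / N ≤ p.1 ∧ p.1 ≤ ((v.1 : ℝ) + 1) / N ∧
        (v.2 : ℝ) / N ≤ p.2 ∧ p.2 ≤ ((v.2 : ℝ) + 1) / N}

/-- A subset of `𝕋_K²` is locally constant at scale `1/N` if it is a union of grid squares. -/
def LocallyConst (K N : ℕ) (A : Set (AddCircle (K : ℝ) × AddCircle (K : ℝ))) : Prop :=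
  ∃ S : Set (Fin (N * K) × Fin (N * K)), A = ⋃ v ∈ S, gridSquare K N v

/-- Euclidean distance on the torus `𝕋_K²`. -/
def torusDist {K : ℝ} (x y : AddCircle K × AddCircle K) : ℝ :=
  Real.sqrt (‖x.1 - y.1‖ ^ 2 + ‖x.2 - y.2‖ ^ 2)

/-- The graph `𝒢(N, K)` on grid squares: two distinct squares are adjacent iff one contains a
point `x` and the other a point `y` with `|x - y| = 1` in the torus. -/
def unitGraph (K N : ℕ) : SimpleGraph (Fin (N * K) × Fin (N * K)) :=
  SimpleGraph.fromRel fun v w =>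
    ∃ x ∈ gridSquare K N v, ∃ y ∈ gridSquare K N w, torusDist x y = 1

/-- The subset `A_F ⊆ 𝕋_K²` given by the union of the squares in `F`. -/
def unionSquares (K N : ℕ) (F : Finset (Fin (N * K) × Fin (N * K))) :
    Set (AddCircle (K : ℝ) × AddCircle (K : ℝ)) :=
  ⋃ v ∈ F, gridSquare K N v

/-- An independent set of a simple graph. -/
def IsIndep {V : Type*} (G : SimpleGraph V) (s : Finset V) : Prop :=
  ∀ a ∈ s, ∀ b ∈ s, ¬ G.Adj a b

end

lemma volume_Icc_square (t : ℝ × ℝ) {L : ℝ} (hL : 0 ≤ L) :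
    volume (Set.Icc t (t + (L, L))) = ENNReal.ofReal (L ^ 2) := by
  rw [← Prod.mk.eta (p := t), Prod.mk_add_mk, ← Set.Icc_prod_Icc, Measure.volume_eq_prod,
    Measure.prod_prod, Real.volume_Icc, Real.volume_Icc, add_sub_cancel_left, add_sub_cancel_left,
    ← ENNReal.ofReal_mul hL, sq]

/-- The proportion of the square `[-R, R]²` occupied by a planar set is at most `1`. -/
lemma density_le_one_s14 (A : Set (ℝ × ℝ)) {R : ℝ} (hR : 0 < R) :
    (volume (A ∩ Set.Icc (-R, -R) (R, R))).toReal / (2 * R) ^ 2 ≤ 1 := by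
  have h : Set.Icc (-R, -R) (R, R) = Set.Icc (-R, -R) ((-R, -R) + (2 * R, 2 * R)) := by
    congr 1; ext <;> simp <;> ring
  rw [div_le_one (by positivity), h]
  refine ENNReal.toReal_le_of_le_ofReal (by positivity) ?_
  rw [← volume_Icc_square (-R, -R) (by positivity)]
  exact measure_mono Set.inter_subset_right

lemma eventually_density_le_one (A : Set (ℝ × ℝ)) :
    ∀ᶠ R : ℝ in atTop, (volume (A ∩ Set.Icc (-R, -R) (R, R))).toReal / (2 * R) ^ 2 ≤ 1 :=
  (eventually_gt_atTop 0).mono fun _ => density_le_one_s14 A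

lemma isCoboundedUnder_density (A : Set (ℝ × ℝ)) :
    IsCoboundedUnder (· ≤ ·) atTop
      (fun R : ℝ => (volume (A ∩ Set.Icc (-R, -R) (R, R))).toReal / (2 * R) ^ 2) :=
  IsBoundedUnder.isCoboundedUnder_le
    ⟨0, eventually_map.2 (Eventually.of_forall fun _ => by positivity)⟩

lemma m1Plane_le_one : m1Plane ≤ 1 := by
  refine csSup_le ⟨_, ∅, MeasurableSet.empty, by simp [Avoids1], rfl⟩ ?_
  rintro _ ⟨A, -, -, rfl⟩
  exact limsup_le_of_le (isCoboundedUnder_density A) (eventually_density_le_one A)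

lemma Icc_subset_iUnion_square {R L : ℝ} (hL : 0 < L) :
    Set.Icc (-R, -R) (R, R) ⊆
      ⋃ i ∈ Finset.range (⌊2 * R / L⌋₊ + 1) ×ˢ Finset.range (⌊2 * R / L⌋₊ + 1),
        Set.Icc (-R + i.1 * L, -R + i.2 * L) ((-R + i.1 * L, -R + i.2 * L) + (L, L)) := by
  have key : ∀ x : ℝ, -R ≤ x → x ≤ R → ⌊(x + R) / L⌋₊ < ⌊2 * R / L⌋₊ + 1 ∧
      -R + ⌊(x + R) / L⌋₊ * L ≤ x ∧ x ≤ -R + ⌊(x + R) / L⌋₊ * L + L := by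
    intro x h1 h2
    have h3 : 0 ≤ (x + R) / L := div_nonneg (by linarith) hL.le
    have h4 := Nat.floor_le h3
    have h5 := (Nat.lt_floor_add_one ((x + R) / L)).le
    rw [le_div_iff₀ hL] at h4
    rw [div_le_iff₀ hL] at h5
    refine ⟨Nat.lt_succ_of_le (Nat.floor_mono ?_), by linarith, by linarith⟩
    gcongr
    linarith
  rintro ⟨x, y⟩ ⟨⟨hx1, hy1⟩, hx2, hy2⟩
  obtain ⟨a1, a2, a3⟩ := key x hx1 hx2
  obtain ⟨b1, b2, b3⟩ := key y hy1 hy2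
  simp only [Set.mem_iUnion]
  exact ⟨(_, _), Finset.mk_mem_product (Finset.mem_range.2 a1) (Finset.mem_range.2 b1),
    ⟨a2, b2⟩, a3, b3⟩

/-- Averaging: some square of side `L` carries at least (almost) the upper density. -/
lemma exists_square_of_lt_upperDensity {A : Set (ℝ × ℝ)} {c L : ℝ} (hc : 0 ≤ c) (hL : 0 < L)
    (h : c < upperDensity A) :
    ∃ t : ℝ × ℝ, ENNReal.ofReal (c * L ^ 2) < volume (A ∩ Set.Icc t (t + (L, L))) := by
  by_contra! hA
  obtain ⟨d, hcd, hd⟩ := exists_between h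
  have hfreq := frequently_lt_of_lt_limsup (isCoboundedUnder_density A) hd
  have hlim : Tendsto (fun R : ℝ => c * (1 + L / (2 * R)) ^ 2) atTop (nhds c) := by
    have h1 : Tendsto (fun R : ℝ => L / (2 * R)) atTop (nhds 0) :=
      (tendsto_id.const_mul_atTop two_pos).const_div_atTop L
    simpa using ((h1.const_add 1).pow 2).const_mul c
  obtain ⟨R, hR1, hR2, hR⟩ :=
    (hfreq.and_eventually ((hlim.eventually_lt_const hcd).and (eventually_gt_atTop 0))).exists
  set n := ⌊2 * R / L⌋₊ + 1 with hn
  have hvol : volume (A ∩ Set.Icc (-R, -R) (R, R)) ≤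
      ENNReal.ofReal ((n : ℝ) ^ 2 * (c * L ^ 2)) := by
    calc volume (A ∩ Set.Icc (-R, -R) (R, R))
        ≤ volume (⋃ i ∈ Finset.range n ×ˢ Finset.range n, A ∩
          Set.Icc (-R + i.1 * L, -R + i.2 * L) ((-R + i.1 * L, -R + i.2 * L) + (L, L))) := by
          rw [← Set.inter_iUnion₂]
          exact measure_mono (Set.inter_subset_inter_right _ (Icc_subset_iUnion_square hL))
      _ ≤ ∑ i ∈ Finset.range n ×ˢ Finset.range n, volume (A ∩
          Set.Icc (-R + i.1 * L, -R + i.2 * L) ((-R + i.1 * L, -R + i.2 * L) + (L, L))) :=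
          measure_biUnion_finset_le _ _
      _ ≤ ∑ _i ∈ Finset.range n ×ˢ Finset.range n, ENNReal.ofReal (c * L ^ 2) :=
          Finset.sum_le_sum fun i _ => hA _
      _ = ENNReal.ofReal ((n : ℝ) ^ 2 * (c * L ^ 2)) := by
          rw [Finset.sum_const, Finset.card_product, Finset.card_range, nsmul_eq_mul,
            ENNReal.ofReal_mul (p := (n : ℝ) ^ 2) (by positivity), ← sq, ← Nat.cast_pow,
            ENNReal.ofReal_natCast]
  have hreal := ENNReal.toReal_le_of_le_ofReal (by positivity) hvol
  have hnL : n * L ≤ 2 * R + L := by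
    have h1 := Nat.floor_le (show 0 ≤ 2 * R / L by positivity)
    rw [le_div_iff₀ hL] at h1
    push_cast [hn]
    linarith
  rw [lt_div_iff₀ (by positivity)] at hR1
  have h2 : (n : ℝ) ^ 2 * (c * L ^ 2) ≤ c * (2 * R + L) ^ 2 := by
    calc (n : ℝ) ^ 2 * (c * L ^ 2) = c * (n * L) ^ 2 := by ring
      _ ≤ _ := by gcongr
  have h3 : c * (2 * R + L) ^ 2 = c * (1 + L / (2 * R)) ^ 2 * (2 * R) ^ 2 := by
    field_simp
  have h4 := mul_le_mul_of_nonneg_right hR2.le (sq_nonneg (2 * R))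
  linarith

/-- A compact 1-avoiding subset of `[0, L]²` of nearly optimal measure. -/
lemma exists_isCompact_avoids1 {c L : ℝ} (hc : 0 ≤ c) (hL : 0 < L) (h : c < m1Plane) :
    ∃ C : Set (ℝ × ℝ), IsCompact C ∧ Avoids1 C ∧ C ⊆ Set.Icc 0 (L, L) ∧
      ENNReal.ofReal (c * L ^ 2) < volume C := by
  obtain ⟨_, ⟨A, hAm, hA, rfl⟩, hcA⟩ := exists_lt_of_lt_csSup (by
    exact ⟨_, ∅, MeasurableSet.empty, by simp [Avoids1], rfl⟩) h
  obtain ⟨t, ht⟩ := exists_square_of_lt_upperDensity hc hL hcA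
  obtain ⟨C, hCA, hC, hCv⟩ := (hAm.inter measurableSet_Icc).exists_lt_isCompact ht
  refine ⟨(fun p => p + t) ⁻¹' C, (Homeomorph.addRight t).isCompact_preimage.2 hC, ?_, ?_, ?_⟩
  · intro p hp q hq
    simpa [euDist] using hA _ (hCA hp).1 _ (hCA hq).1
  · intro p hp
    obtain ⟨h1, h2⟩ := (hCA hp).2
    rw [add_comm t] at h2
    exact ⟨by simpa using h1, by simpa using h2⟩
  · rwa [measure_preimage_add_right]

/-- On a compact 1-avoiding set the squared distances stay uniformly away from `1`. -/
lemma exists_gap {C : Set (ℝ × ℝ)} (hC : IsCompact C) (hA : Avoids1 C) :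
    ∃ δ > 0, ∀ a ∈ C, ∀ b ∈ C, δ ≤ |(a.1 - b.1) ^ 2 + (a.2 - b.2) ^ 2 - 1| := by
  rcases C.eq_empty_or_nonempty with rfl | hne
  · exact ⟨1, one_pos, by simp⟩
  obtain ⟨⟨a, b⟩, hab, hmin⟩ := (hC.prod hC).exists_isMinOn (hne.prod hne)
    (f := fun x : (ℝ × ℝ) × (ℝ × ℝ) => |(x.1.1 - x.2.1) ^ 2 + (x.1.2 - x.2.2) ^ 2 - 1|)
    (by fun_prop)
  refine ⟨_, abs_pos.2 fun h0 => hA a hab.1 b hab.2 ?_, fun p hp q hq =>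
    hmin (Set.mk_mem_prod hp hq)⟩
  rw [euDist, sub_eq_zero.1 h0, Real.sqrt_one]

/-- The grid square with index `v`, as a subset of the plane. -/
def planeSquare {n : ℕ} (N : ℕ) (v : Fin n × Fin n) : Set (ℝ × ℝ) :=
  Set.Icc ((v.1 : ℝ) / N, (v.2 : ℝ) / N) ((((v.1 : ℝ) + 1) / N), (((v.2 : ℝ) + 1) / N))

lemma volume_planeSquare {n N : ℕ} (v : Fin n × Fin n) :
    volume (planeSquare N v) = ENNReal.ofReal ((1 / N : ℝ) ^ 2) := by
  rw [← volume_Icc_square ((v.1 : ℝ) / N, (v.2 : ℝ) / N) (by positivity), planeSquare]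
  simp [add_div]

open Classical in
/-- The indices of the grid squares that meet `C`. -/
noncomputable def squaresMeeting (K N : ℕ) (C : Set (ℝ × ℝ)) : Finset (Fin (N * K) × Fin (N * K)) :=
  {v | (C ∩ planeSquare N v).Nonempty}

lemma volume_le_card_squaresMeeting {K N : ℕ} (hN : 0 < N) {L : ℝ} (hL : L < K)
    {C : Set (ℝ × ℝ)} (hC : C ⊆ Set.Icc 0 (L, L)) :
    volume C ≤ ENNReal.ofReal ((squaresMeeting K N C).card * (1 / N : ℝ) ^ 2) := by
  have hN' : (0 : ℝ) < N := by exact_mod_cast hN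
  have key : ∀ x : ℝ, 0 ≤ x → x ≤ L →
      ∃ i : Fin (N * K), (i : ℝ) / N ≤ x ∧ x ≤ ((i : ℝ) + 1) / N := by
    intro x h0 hx
    have h1 : 0 ≤ N * x := by positivity
    refine ⟨⟨⌊N * x⌋₊, (Nat.floor_lt h1).2 ?_⟩, ?_, ?_⟩
    · push_cast
      gcongr
      linarith
    · rw [div_le_iff₀' hN']
      exact Nat.floor_le h1
    · rw [le_div_iff₀' hN']
      exact (Nat.lt_floor_add_one _).le
  have hcover : C ⊆ ⋃ v ∈ squaresMeeting K N C, planeSquare N v := by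
    intro p hp
    obtain ⟨⟨h1, h2⟩, h3, h4⟩ := hC hp
    obtain ⟨i, hi1, hi2⟩ := key p.1 h1 h3
    obtain ⟨j, hj1, hj2⟩ := key p.2 h2 h4
    have hmem : p ∈ planeSquare N (i, j) := ⟨⟨hi1, hj1⟩, hi2, hj2⟩
    simp only [Set.mem_iUnion]
    exact ⟨(i, j), by simpa [squaresMeeting] using ⟨p, hp, hmem⟩, hmem⟩
  calc volume C ≤ ∑ v ∈ squaresMeeting K N C, volume (planeSquare N v) :=
        (measure_mono hcover).trans (measure_biUnion_finset_le _ _)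
    _ = _ := by
        simp_rw [volume_planeSquare]
        rw [Finset.sum_const, nsmul_eq_mul, ENNReal.ofReal_mul (by positivity),
          ENNReal.ofReal_natCast]

/-- Points of `[0, M]` with `M < K - 1` whose circle distance is at most `1` do not wrap around. -/
lemma addCircle_norm_eq_abs {K M x y : ℝ} (hMK : M + 1 < K) (hx0 : 0 ≤ x) (hxM : x ≤ M)
    (hy0 : 0 ≤ y) (hyM : y ≤ M) (h : ‖(x : AddCircle K) - (y : AddCircle K)‖ ≤ 1) :
    ‖(x : AddCircle K) - (y : AddCircle K)‖ = |x - y| := by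
  rw [← AddCircle.coe_sub, AddCircle.norm_eq] at h ⊢
  set m : ℤ := round (K⁻¹ * (x - y))
  obtain ⟨h1, h2⟩ := abs_le.1 h
  have hm : m = 0 := by
    by_contra hm
    rcases lt_or_gt_of_ne hm with hm | hm
    · have : (m : ℝ) ≤ -1 := by exact_mod_cast Int.le_sub_one_of_lt hm
      nlinarith
    · have : (1 : ℝ) ≤ m := by exact_mod_cast hm
      nlinarith
  simp [hm]

lemma abs_sq_sub_sq_le {u w η : ℝ} (hu : |u| ≤ 1) (huw : |w - u| ≤ η) (hη : η ≤ 1) :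
    |w ^ 2 - u ^ 2| ≤ 3 * η := by
  have h1 : |w + u| ≤ 3 := by
    rw [abs_le] at *
    constructor <;> linarith [hu.1, hu.2, huw.1, huw.2]
  rw [show w ^ 2 - u ^ 2 = (w + u) * (w - u) by ring, abs_mul]
  exact mul_le_mul h1 huw (abs_nonneg _) (by norm_num)

lemma torusDist_ne_one_of_squaresMeeting {K N : ℕ} {C : Set (ℝ × ℝ)} {δ : ℝ}
    (hC : C ⊆ Set.Icc 0 ((K : ℝ) - 2, (K : ℝ) - 2))
    (hgap : ∀ a ∈ C, ∀ b ∈ C, δ ≤ |(a.1 - b.1) ^ 2 + (a.2 - b.2) ^ 2 - 1|)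
    (hN : 2 ≤ N) (hNδ : 12 / N < δ) {v w : Fin (N * K) × Fin (N * K)}
    (hv : v ∈ squaresMeeting K N C) (hw : w ∈ squaresMeeting K N C)
    {x y : AddCircle (K : ℝ) × AddCircle (K : ℝ)}
    (hx : x ∈ gridSquare K N v) (hy : y ∈ gridSquare K N w) : torusDist x y ≠ 1 := by
  intro hxy
  obtain ⟨p, rfl, hp1, hp2, hp3, hp4⟩ := hx
  obtain ⟨q, rfl, hq1, hq2, hq3, hq4⟩ := hy
  simp only [squaresMeeting, Finset.mem_filter, Finset.mem_univ, true_and] at hv hw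
  obtain ⟨a, haC, ⟨ha1, ha3⟩, ha2, ha4⟩ := hv
  obtain ⟨b, hbC, ⟨hb1, hb3⟩, hb2, hb4⟩ := hw
  obtain ⟨-, haL1, haL2⟩ := hC haC
  obtain ⟨-, hbL1, hbL2⟩ := hC hbC
  dsimp only at *
  have hN' : (1 : ℝ) / N ≤ 1 / 2 :=
    one_div_le_one_div_of_le two_pos (by exact_mod_cast hN)
  rw [add_div] at hp2 hp4 hq2 hq4 ha2 ha4 hb2 hb4
  have hv1 : 0 ≤ (v.1 : ℝ) / N := by positivity
  have hv2 : 0 ≤ (v.2 : ℝ) / N := by positivity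
  have hw1 : 0 ≤ (w.1 : ℝ) / N := by positivity
  have hw2 : 0 ≤ (w.2 : ℝ) / N := by positivity
  rw [torusDist, Real.sqrt_eq_one] at hxy
  dsimp only at hxy
  have hn1 := addCircle_norm_eq_abs (K := K) (M := (K : ℝ) - 3 / 2) (x := p.1) (y := q.1)
    (by linarith) (by linarith) (by linarith) (by linarith) (by linarith)
    (by nlinarith [sq_nonneg ‖(p.2 : AddCircle (K : ℝ)) - (q.2 : AddCircle (K : ℝ))‖])
  have hn2 := addCircle_norm_eq_abs (K := K) (M := (K : ℝ) - 3 / 2) (x := p.2) (y := q.2)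
    (by linarith) (by linarith) (by linarith) (by linarith) (by linarith)
    (by nlinarith [sq_nonneg ‖(p.1 : AddCircle (K : ℝ)) - (q.1 : AddCircle (K : ℝ))‖])
  rw [hn1, hn2, sq_abs, sq_abs] at hxy
  have e1 := abs_sq_sub_sq_le (u := p.1 - q.1) (w := a.1 - b.1) (η := 2 * (1 / N))
    (abs_le_one_iff_mul_self_le_one.2 (by nlinarith [sq_nonneg (p.2 - q.2)]))
    (abs_le.2 ⟨by linarith, by linarith⟩) (by linarith)
  have e2 := abs_sq_sub_sq_le (u := p.2 - q.2) (w := a.2 - b.2) (η := 2 * (1 / N))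
    (abs_le_one_iff_mul_self_le_one.2 (by nlinarith [sq_nonneg (p.1 - q.1)]))
    (abs_le.2 ⟨by linarith, by linarith⟩) (by linarith)
  have hle : |(a.1 - b.1) ^ 2 + (a.2 - b.2) ^ 2 - 1| ≤ 12 / (N : ℝ) := by
    rw [abs_le] at e1 e2 ⊢
    have h12 : (12 : ℝ) / N = 12 * (1 / N) := by ring
    constructor <;> linarith [e1.1, e1.2, e2.1, e2.2]
  linarith [hgap a haC b hbC]

lemma isIndep_squaresMeeting {K N : ℕ} {C : Set (ℝ × ℝ)} {δ : ℝ}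
    (hC : C ⊆ Set.Icc 0 ((K : ℝ) - 2, (K : ℝ) - 2))
    (hgap : ∀ a ∈ C, ∀ b ∈ C, δ ≤ |(a.1 - b.1) ^ 2 + (a.2 - b.2) ^ 2 - 1|)
    (hN : 2 ≤ N) (hNδ : 12 / N < δ) : IsIndep (unitGraph K N) (squaresMeeting K N C) := by
  intro v hv w hw hadj
  rw [unitGraph, SimpleGraph.fromRel_adj] at hadj
  obtain ⟨-, ⟨x, hx, y, hy, hxy⟩ | ⟨x, hx, y, hy, hxy⟩⟩ := hadj
  · exact torusDist_ne_one_of_squaresMeeting hC hgap hN hNδ hv hw hx hy hxy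
  · exact torusDist_ne_one_of_squaresMeeting hC hgap hN hNδ hw hv hx hy hxy

/-- For every `ε > 0` there is `K₀` such that for every `K ≥ K₀` there is `N₀ = N₀(K, ε)` with:
for all `N ≥ N₀`, the independence number of `𝒢(N, K)` is at least `(m₁(ℝ²) − ε)·(NK)²`. -/
theorem unitGraph_independence_number (ε : ℝ) (hε : 0 < ε) :
    ∃ K₀ : ℕ, ∀ K : ℕ, K₀ ≤ K → ∃ N₀ : ℕ, ∀ N : ℕ, N₀ ≤ N →
      ∃ s : Finset (Fin (N * K) × Fin (N * K)), IsIndep (unitGraph K N) s ∧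
        (m1Plane - ε) * ((N : ℝ) * K) ^ 2 ≤ (s.card : ℝ) := by
  rcases le_or_gt m1Plane ε with hm | hm
  · exact ⟨0, fun K _ => ⟨0, fun N _ => ⟨∅, by simp [IsIndep], by
      simpa using mul_nonpos_of_nonpos_of_nonneg (sub_nonpos.2 hm) (sq_nonneg ((N : ℝ) * K))⟩⟩⟩
  refine ⟨max 3 ⌈8 / ε⌉₊, fun K hK => ?_⟩
  have hK3 : (3 : ℝ) ≤ K := by exact_mod_cast (le_max_left _ _).trans hK
  have hKε : 8 / ε ≤ K := (Nat.le_ceil _).trans (by exact_mod_cast (le_max_right _ _).trans hK)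
  rw [div_le_iff₀ hε] at hKε
  obtain ⟨C, hCc, hCa, hCL, hCv⟩ := exists_isCompact_avoids1 (c := m1Plane - ε / 2)
    (L := (K : ℝ) - 2) (by linarith) (by linarith) (by linarith)
  obtain ⟨δ, hδ, hgap⟩ := exists_gap hCc hCa
  refine ⟨max 2 (⌊12 / δ⌋₊ + 1), fun N hN => ?_⟩
  have hN2 : 2 ≤ N := (le_max_left _ _).trans hN
  have hN0 : (0 : ℝ) < N := by exact_mod_cast two_pos.trans_le hN2
  have hNδ : 12 / N < δ := by
    rw [div_lt_comm₀ hN0 hδ]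
    exact (Nat.lt_floor_add_one _).trans_le (by exact_mod_cast (le_max_right _ _).trans hN)
  refine ⟨squaresMeeting K N C, isIndep_squaresMeeting hCL hgap hN2 hNδ, ?_⟩
  have hcard := hCv.le.trans
    (volume_le_card_squaresMeeting (two_pos.trans_le hN2) (show (K : ℝ) - 2 < K by linarith) hCL)
  rw [ENNReal.ofReal_le_ofReal_iff (by positivity), one_div, inv_pow, ← div_eq_mul_inv,
    le_div_iff₀ (by positivity)] at hcard
  have hmain : (m1Plane - ε) * (K : ℝ) ^ 2 ≤ (m1Plane - ε / 2) * ((K : ℝ) - 2) ^ 2 := by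
    have h1 : (m1Plane - ε / 2) * (4 * K - 4) ≤ 1 * (4 * K - 4) :=
      mul_le_mul_of_nonneg_right (by linarith [m1Plane_le_one]) (by linarith)
    nlinarith
  calc (m1Plane - ε) * ((N : ℝ) * K) ^ 2 = (m1Plane - ε) * (K : ℝ) ^ 2 * (N : ℝ) ^ 2 := by ring
    _ ≤ (m1Plane - ε / 2) * ((K : ℝ) - 2) ^ 2 * (N : ℝ) ^ 2 := by gcongr
    _ ≤ _ := hcard
end
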